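/- h(m) = m²/12 + o(m²), i.e. the limit as m → ∞ of h(m)/m² equals 1/12. -/

import Mathlib

/-- `gP P` is the number of distinct first coordinates of `P`, plus the number of distinct
second coordinates of `P`, plus the number of distinct values `x + y` over `(x,y) ∈ P`. -/
def gP (P : Finset (ℤ × ℤ)) : ℕ :=
  (P.image Prod.fst).card + (P.image Prod.snd).card + (P.image (fun p => p.1 + p.2)).card

/-- `hmax m` is the largest size of a finite set `P ⊆ ℤ × ℤ` with `gP P ≤ m`. -/
noncomputable def hmax (m : ℕ) : ℕ :=
  sSup {k | ∃ P : Finset (ℤ × ℤ), gP P ≤ m ∧ P.card = k}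

/-- Each step removes the hook formed by the points whose first coordinate is the maximum of `A`
or whose second coordinate is the minimum of `B`; sums are pairwise distinct along a hook. -/
theorem card_le_mul_add_mul_of_subset_product (t : ℕ) (A B C : Finset ℤ) (P : Finset (ℤ × ℤ))
    (hP : P ⊆ A ×ˢ B) (hC : ∀ p ∈ P, p.1 + p.2 ∈ C) :
    P.card ≤ t * C.card + (A.card - t) * (B.card - t) := by
  induction t generalizing A B P with
  | zero => simpa using Finset.card_le_card hP
  | succ t ih =>
    rcases P.eq_empty_or_nonempty with rfl | ⟨p₀, hp₀⟩
    · simp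
    have hmem : ∀ p ∈ P, p.1 ∈ A ∧ p.2 ∈ B := fun p hp => Finset.mem_product.1 (hP hp)
    have hA : A.Nonempty := ⟨_, (hmem p₀ hp₀).1⟩
    have hB : B.Nonempty := ⟨_, (hmem p₀ hp₀).2⟩
    set a := A.max' hA
    set b := B.min' hB
    have hhook : (P.filter fun p => p.1 = a ∨ p.2 = b).card ≤ C.card := by
      refine Finset.card_le_card_of_injOn (fun p => p.1 + p.2)
        (fun p hp => hC p (Finset.mem_filter.1 hp).1) ?_
      rintro ⟨x, y⟩ hp ⟨x', y'⟩ hp' h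
      obtain ⟨hp, hpab⟩ := Finset.mem_filter.1 hp
      obtain ⟨hp', hpab'⟩ := Finset.mem_filter.1 hp'
      have hx := A.le_max' _ (hmem _ hp).1
      have hx' := A.le_max' _ (hmem _ hp').1
      have hy := B.min'_le _ (hmem _ hp).2
      have hy' := B.min'_le _ (hmem _ hp').2
      simp only [Prod.mk.injEq] at *
      change x ≤ a at hx
      change x' ≤ a at hx'
      change b ≤ y at hy
      change b ≤ y' at hy'
      omega
    have hrest := ih (A.erase a) (B.erase b) (P.filter fun p => ¬(p.1 = a ∨ p.2 = b))
      (fun p hp => by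
        obtain ⟨hp, hpab⟩ := Finset.mem_filter.1 hp
        rw [not_or] at hpab
        exact Finset.mem_product.2 ⟨Finset.mem_erase.2 ⟨hpab.1, (hmem p hp).1⟩,
          Finset.mem_erase.2 ⟨hpab.2, (hmem p hp).2⟩⟩)
      (fun p hp => hC p (Finset.mem_filter.1 hp).1)
    rw [Finset.card_erase_of_mem (A.max'_mem hA), Finset.card_erase_of_mem (B.min'_mem hB),
      Nat.sub_sub, Nat.sub_sub, Nat.add_comm 1 t] at hrest
    rw [← Finset.card_filter_add_card_filter_not (s := P) (fun p => p.1 = a ∨ p.2 = b)]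
    linarith

theorem twelve_mul_card_le (P : Finset (ℤ × ℤ)) : 12 * P.card ≤ gP P ^ 2 + 3 := by
  have key := fun t => card_le_mul_add_mul_of_subset_product t (P.image Prod.fst)
    (P.image Prod.snd) (P.image fun p => p.1 + p.2) P
    (fun p hp => Finset.mem_product.2
      ⟨Finset.mem_image_of_mem _ hp, Finset.mem_image_of_mem _ hp⟩)
    (fun p hp => Finset.mem_image_of_mem (fun p : ℤ × ℤ => p.1 + p.2) hp)
  unfold gP
  generalize (P.image Prod.fst).card = p at *
  generalize (P.image Prod.snd).card = q at *
  generalize (P.image fun p => p.1 + p.2).card = c at *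
  generalize P.card = n at *
  rcases le_total (p + q) c with hc | hc
  · have h := key 0
    simp only [zero_mul, zero_add, Nat.sub_zero] at h
    zify at *
    nlinarith [sq_nonneg ((p : ℤ) - q)]
  rcases le_total (p + c) q with hq | hq
  · have h := key p
    simp only [Nat.sub_self, zero_mul, add_zero] at h
    zify at *
    nlinarith [sq_nonneg ((p : ℤ) - c)]
  rcases le_total (q + c) p with hp | hp
  · have h := key q
    simp only [Nat.sub_self, mul_zero, add_zero] at h
    zify at *
    nlinarith [sq_nonneg ((q : ℤ) - c)]
  obtain ⟨t, d, hd, ht⟩ : ∃ t d : ℕ, d ≤ 1 ∧ p + q = c + 2 * t + d :=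
    ⟨(p + q - c) / 2, (p + q - c) % 2, by omega, by omega⟩
  have h := key t
  zify [show t ≤ p by omega, show t ≤ q by omega] at h hd ht ⊢
  have hd₂ : (d : ℤ) ^ 2 ≤ 1 := pow_le_one₀ (by positivity) hd
  have hc' : (c : ℤ) = p + q - 2 * t - d := by linarith
  have h_identity : ((p : ℤ) + q + c) ^ 2 + 3 - 12 * (t * c + (p - t) * (q - t)) =
      2 * ((p - q) ^ 2 + (p - c) ^ 2 + (q - c) ^ 2) + 3 * (1 - d ^ 2) := by
    rw [hc']
    ring
  linarith [sq_nonneg ((p : ℤ) - q), sq_nonneg ((p : ℤ) - c), sq_nonneg ((q : ℤ) - c)]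

theorem exists_card_eq_three_mul_sq (k : ℕ) :
    ∃ P : Finset (ℤ × ℤ), gP P ≤ 6 * k ∧ P.card = 3 * k ^ 2 := by
  let f : ℕ × ℕ → ℤ × ℤ := fun p =>
    if p.2 < k + p.1 then ((p.1 : ℤ), 2 * k - 1 - p.2) else ((k : ℤ) + p.1, p.2 - (k + p.1))
  have hf : ∀ p ∈ Finset.range k ×ˢ Finset.range (3 * k),
      (f p).1 ∈ Finset.Ico (0 : ℤ) (2 * k) ∧ (f p).2 ∈ Finset.Ico (0 : ℤ) (2 * k) ∧
        (f p).1 + (f p).2 ∈ Finset.Ico (k : ℤ) (3 * k) := by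
    rintro ⟨i, j⟩ h
    simp only [Finset.mem_product, Finset.mem_range] at h
    simp only [f, Finset.mem_Ico]
    split_ifs <;> dsimp only <;> omega
  refine ⟨(Finset.range k ×ˢ Finset.range (3 * k)).image f, ?_, ?_⟩
  · have h₁ : ((Finset.range k ×ˢ Finset.range (3 * k)).image f).image Prod.fst ⊆
        Finset.Ico (0 : ℤ) (2 * k) := by
      rw [Finset.image_image, Finset.image_subset_iff]
      exact fun p hp => (hf p hp).1
    have h₂ : ((Finset.range k ×ˢ Finset.range (3 * k)).image f).image Prod.snd ⊆
        Finset.Ico (0 : ℤ) (2 * k) := by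
      rw [Finset.image_image, Finset.image_subset_iff]
      exact fun p hp => (hf p hp).2.1
    have h₃ : ((Finset.range k ×ˢ Finset.range (3 * k)).image f).image (fun p => p.1 + p.2) ⊆
        Finset.Ico (k : ℤ) (3 * k) := by
      rw [Finset.image_image, Finset.image_subset_iff]
      exact fun p hp => (hf p hp).2.2
    have h₁ := Finset.card_le_card h₁
    have h₂ := Finset.card_le_card h₂
    have h₃ := Finset.card_le_card h₃
    rw [Int.card_Ico] at h₁ h₂ h₃
    unfold gP
    omega
  · rw [Finset.card_image_of_injOn, Finset.card_product, Finset.card_range, Finset.card_range]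
    · ring
    rintro ⟨i, j⟩ h ⟨i', j'⟩ h' hij
    simp only [Finset.coe_product, Set.mem_prod, Finset.mem_coe, Finset.mem_range] at h h'
    simp only [f] at hij
    split_ifs at hij <;> simp only [Prod.mk.injEq] at hij ⊢ <;> omega

theorem twelve_mul_card_le_of_gP_le {m : ℕ} {P : Finset (ℤ × ℤ)} (hP : gP P ≤ m) :
    12 * P.card ≤ m ^ 2 + 3 :=
  (twelve_mul_card_le P).trans (by gcongr)

theorem card_le_hmax {m : ℕ} {P : Finset (ℤ × ℤ)} (hP : gP P ≤ m) : P.card ≤ hmax m := by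
  refine le_csSup ⟨m ^ 2 + 3, ?_⟩ ⟨P, hP, rfl⟩
  rintro _ ⟨Q, hQ, rfl⟩
  have := twelve_mul_card_le_of_gP_le hQ
  omega

theorem twelve_mul_hmax_le (m : ℕ) : 12 * hmax m ≤ m ^ 2 + 3 := by
  have h : hmax m ≤ (m ^ 2 + 3) / 12 := by
    refine csSup_le ⟨0, ∅, by simp [gP], rfl⟩ ?_
    rintro _ ⟨Q, hQ, rfl⟩
    have := twelve_mul_card_le_of_gP_le hQ
    omega
  omega

theorem sq_sub_le_twelve_mul_hmax (m : ℕ) : (m - 5) ^ 2 ≤ 12 * hmax m := by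
  obtain ⟨P, hP, hcard⟩ := exists_card_eq_three_mul_sq (m / 6)
  have h := card_le_hmax (hP.trans (Nat.mul_div_le m 6))
  calc (m - 5) ^ 2 ≤ (6 * (m / 6)) ^ 2 := by gcongr; omega
    _ = 12 * (3 * (m / 6) ^ 2) := by ring
    _ ≤ 12 * hmax m := by rw [← hcard]; gcongr

/-- `h(m) = m²/12 + o(m²)`. -/
theorem stmt_11 :
    Filter.Tendsto (fun m : ℕ => (hmax m : ℝ) / (m : ℝ) ^ 2)
      Filter.atTop (nhds (1 / 12)) := by
  have hinv : Filter.Tendsto (fun m : ℕ => ((m : ℝ))⁻¹) Filter.atTop (nhds 0) :=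
    tendsto_inv_atTop_nhds_zero_nat
  have hlower : Filter.Tendsto (fun m : ℕ => (1 - 5 * (m : ℝ)⁻¹) ^ 2 / 12)
      Filter.atTop (nhds (1 / 12)) := by
    simpa using (((hinv.const_mul 5).const_sub 1).pow 2).div_const 12
  have hupper : Filter.Tendsto (fun m : ℕ => (1 + 3 * (m : ℝ)⁻¹ ^ 2) / 12)
      Filter.atTop (nhds (1 / 12)) := by
    simpa using (((hinv.pow 2).const_mul 3).const_add 1).div_const 12
  refine tendsto_of_tendsto_of_tendsto_of_le_of_le' hlower hupper ?_ ?_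
  · filter_upwards [Filter.eventually_ge_atTop 5] with m hm
    have h : ((m : ℝ) - 5) ^ 2 ≤ 12 * hmax m := by
      have := sq_sub_le_twelve_mul_hmax m
      rify [hm] at this
      exact this
    have hm₀ : (0 : ℝ) < m := by positivity
    rw [le_div_iff₀ (by positivity)]
    field_simp
    linarith
  · filter_upwards [Filter.eventually_ge_atTop 5] with m hm
    have h : 12 * (hmax m : ℝ) ≤ (m : ℝ) ^ 2 + 3 := by exact_mod_cast twelve_mul_hmax_le m
    have hm₀ : (0 : ℝ) < m := by positivity
    rw [div_le_iff₀ (by positivity)]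
    field_simp
    linarith
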